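/- Let D₂ be the subgroup of SO(3) consisting of the four diagonal matrices {diag(1,1,1), diag(1,−1,−1), diag(−1,1,−1), diag(−1,−1,1)}. Then the fundamental group of the quotient space SO(3)/D₂ (the space of left cosets with the quotient topology) is isomorphic, as a group, to the quaternion group Q₈. -/

import Mathlib

/-- `SO(3)`: the group of 3×3 real orthogonal matrices of determinant 1, realized as the
kernel of the determinant on the orthogonal group (so that it is a genuine subgroup,
topologized as a subspace of the 3×3 real matrices). -/
noncomputable def SO3 : Subgroup ↥(Matrix.orthogonalGroup (Fin 3) ℝ) :=
  MonoidHom.ker (Matrix.detMonoidHom.comp (Matrix.orthogonalGroup (Fin 3) ℝ).subtype)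

/-- The four diagonal matrices `diag(1,1,1)`, `diag(1,-1,-1)`, `diag(-1,1,-1)`,
`diag(-1,-1,1)`, viewed as a subset of `SO(3)`. -/
def D2Set : Set ↥SO3 :=
  {x | ((x : ↥(Matrix.orthogonalGroup (Fin 3) ℝ)) : Matrix (Fin 3) (Fin 3) ℝ) ∈
    ({Matrix.diagonal ![1, 1, 1], Matrix.diagonal ![1, -1, -1],
      Matrix.diagonal ![-1, 1, -1], Matrix.diagonal ![-1, -1, 1]} :
      Set (Matrix (Fin 3) (Fin 3) ℝ))}

open Metric Set unitInterval in
/-- A path in the unit sphere of a space of dimension at least three is homotopic, rel endpoints,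
to a path missing a point of the sphere. -/
theorem exists_homotopic_path_avoiding_point {E : Type*} [NormedAddCommGroup E]
    [NormedSpace ℝ E] [FiniteDimensional ℝ E] (hE : 2 < Module.finrank ℝ E)
    {x y : sphere (0 : E) 1} (p : Path x y) :
    ∃ (q : Path x y) (w : sphere (0 : E) 1), p.Homotopic q ∧ ∀ t, q t ≠ w := by
  let f : C(I, E) := ⟨fun t ↦ (p t : E), by fun_prop⟩
  obtain ⟨n, hn, hn0⟩ := ((Metric.tendsto_nhds.1 (bernsteinApproximation_uniform f) 1
    one_pos).and (Filter.eventually_ne_atTop 0)).exists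
  set g : C(I, E) := bernsteinApproximation n f with hg
  have hf (t : I) : ‖f t‖ = 1 := by simp [f]
  have hfg (t : I) : ‖g t - f t‖ < 1 := by
    rw [← dist_eq_norm]
    exact (ContinuousMap.dist_apply_le_dist t).trans_lt hn
  have hne (s t : I) : f t + (s : ℝ) • (g t - f t) ≠ 0 := by
    intro h
    have h₁ : ‖f t‖ = ‖(s : ℝ) • (g t - f t)‖ := by
      rw [← norm_neg, ← eq_neg_of_add_eq_zero_right h]
    rw [hf, norm_smul, Real.norm_of_nonneg s.2.1] at h₁
    nlinarith [hfg t, s.2.1, s.2.2, norm_nonneg (g t - f t)]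
  let H (s t : I) : sphere (0 : E) 1 :=
    ⟨‖f t + (s : ℝ) • (g t - f t)‖⁻¹ • (f t + (s : ℝ) • (g t - f t)), by
      rw [mem_sphere_zero_iff_norm, norm_smul, norm_inv, norm_norm,
        inv_mul_cancel₀ (norm_ne_zero_iff.2 (hne s t))]⟩
  have hH : Continuous fun st : I × I ↦ H st.1 st.2 := by
    have hc : Continuous fun st : I × I ↦ f st.2 + (st.1 : ℝ) • (g st.2 - f st.2) := by fun_prop
    exact ((hc.norm.inv₀ fun st ↦ norm_ne_zero_iff.2 (hne st.1 st.2)).smul hc).subtype_mk _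
  have hH₀ (t : I) : H 0 t = p t := Subtype.ext <| by simp [H, f]
  have hHx (s : I) : H s 0 = x := Subtype.ext <| by simp [H, hg, f]
  have hHy (s : I) : H s 1 = y := Subtype.ext <| by
    simp [H, hg, bernsteinApproximation.apply_one hn0, f]
  have hgR : ∃ G : ℝ → E, ContDiff ℝ 1 G ∧ ∀ t : I, g t = G t := by
    refine ⟨fun t ↦ ∑ k : Fin (n + 1), ((n.choose k : ℝ) * t ^ (k : ℕ) * (1 - t) ^ (n - k)) •
      f (bernstein.z k), by fun_prop, fun t ↦ ?_⟩
    simp [hg, bernsteinApproximation.apply, bernstein_apply]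
  obtain ⟨G, hG, hgG⟩ := hgR
  have hG₂ : ContDiff ℝ 1 fun st : ℝ × ℝ ↦ st.1 • G st.2 := by fun_prop
  obtain ⟨v, hv⟩ := (hG₂.dense_compl_range_of_finrank_lt_finrank (by simp [hE])).nonempty
  have hv0 : v ≠ 0 := fun h ↦ hv ⟨(0, 0), by simp [h]⟩
  refine ⟨⟨⟨H 1, by fun_prop⟩, hHx 1, hHy 1⟩, ⟨‖v‖⁻¹ • v, by simp [norm_smul, hv0]⟩, ⟨?_⟩, ?_⟩
  · exact
      { toFun := fun st ↦ H st.1 st.2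
        continuous_toFun := hH
        map_zero_left := hH₀
        map_one_left := fun _ ↦ rfl
        prop' := by
          rintro s t (rfl | rfl)
          · simp [hHx]
          · simp [hHy] }
  · intro t ht
    have ht' : ‖g t‖⁻¹ • g t = ‖v‖⁻¹ • v := by
      simpa [H, -smul_add] using congrArg Subtype.val ht
    refine hv ⟨(‖v‖ * ‖g t‖⁻¹, t), ?_⟩
    simp only [← hgG, mul_smul, ht']
    simp [hv0]

open Metric in
/-- The unit sphere of a real inner product space of finite dimension at least three is simply
connected. -/
theorem simplyConnectedSpace_sphere {E : Type*} [NormedAddCommGroup E]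
    [InnerProductSpace ℝ E] [FiniteDimensional ℝ E] (hE : 2 < Module.finrank ℝ E) :
    SimplyConnectedSpace (sphere (0 : E) 1) := by
  rw [simply_connected_iff_loops_nullhomotopic]
  refine ⟨isPathConnected_iff_pathConnectedSpace.1 <| isPathConnected_sphere
    (Module.lt_rank_of_lt_finrank (by omega)) 0 zero_le_one, fun x p ↦ ?_⟩
  obtain ⟨q, w, hpq, hw⟩ := exists_homotopic_path_avoiding_point hE p
  refine hpq.trans ?_
  have hw1 : ‖(w : E)‖ = 1 := norm_eq_of_mem_sphere w
  have hc : IsSimplyConnected ({w}ᶜ : Set (sphere (0 : E) 1)) := by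
    have := range_stereographic_symm hw1
    rw [← Set.image_univ] at this
    rw [← this, (isOpenEmbedding_stereographic_symm hw1).isEmbedding.isSimplyConnected_image]
    exact (Homeomorph.Set.univ _).toHomotopyEquiv.simplyConnectedSpace
  obtain ⟨F, -⟩ := (isSimplyConnected_iff_exists_homotopy_refl_forall_mem.1 hc).2 x q hw
  exact ⟨F⟩

section

open Metric Quaternion

/-- The matrix of the map `v ↦ q * v * star q` on imaginary quaternions. -/
def conjMatrix (q : ℍ[ℝ]) : Matrix (Fin 3) (Fin 3) ℝ :=
  !![q.re ^ 2 + q.imI ^ 2 - q.imJ ^ 2 - q.imK ^ 2, 2 * (q.imI * q.imJ - q.re * q.imK),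
      2 * (q.imI * q.imK + q.re * q.imJ);
    2 * (q.imI * q.imJ + q.re * q.imK), q.re ^ 2 - q.imI ^ 2 + q.imJ ^ 2 - q.imK ^ 2,
      2 * (q.imJ * q.imK - q.re * q.imI);
    2 * (q.imI * q.imK - q.re * q.imJ), 2 * (q.imJ * q.imK + q.re * q.imI),
      q.re ^ 2 - q.imI ^ 2 - q.imJ ^ 2 + q.imK ^ 2]

theorem conjMatrix_mul (p q : ℍ[ℝ]) : conjMatrix (p * q) = conjMatrix p * conjMatrix q := by
  ext i j
  fin_cases i <;> fin_cases j <;>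
    simp [conjMatrix, Matrix.mul_apply, Fin.sum_univ_three] <;> ring

theorem conjMatrix_one : conjMatrix 1 = 1 := by
  ext i j
  fin_cases i <;> fin_cases j <;> simp [conjMatrix]

theorem sphere_normSq (q : sphere (0 : ℍ[ℝ]) 1) :
    (q : ℍ[ℝ]).re ^ 2 + (q : ℍ[ℝ]).imI ^ 2 + (q : ℍ[ℝ]).imJ ^ 2 + (q : ℍ[ℝ]).imK ^ 2 = 1 := by
  rw [← Quaternion.normSq_def', Quaternion.normSq_eq_norm_mul_self, norm_eq_of_mem_sphere, one_mul]

theorem mem_sphere_of_sq_add_eq_one {q : ℍ[ℝ]}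
    (h : q.re ^ 2 + q.imI ^ 2 + q.imJ ^ 2 + q.imK ^ 2 = 1) : q ∈ sphere (0 : ℍ[ℝ]) 1 := by
  rw [← Quaternion.normSq_def', Quaternion.normSq_eq_norm_mul_self] at h
  rw [mem_sphere_zero_iff_norm]
  nlinarith [norm_nonneg q]

theorem conjMatrix_mem_orthogonalGroup (q : sphere (0 : ℍ[ℝ]) 1) :
    conjMatrix q ∈ Matrix.orthogonalGroup (Fin 3) ℝ := by
  rw [Matrix.mem_orthogonalGroup_iff]
  have h := sphere_normSq q
  ext i j
  fin_cases i <;> fin_cases j <;>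
    simp [conjMatrix, Matrix.mul_apply, Fin.sum_univ_three] <;> grind

theorem det_conjMatrix (q : sphere (0 : ℍ[ℝ]) 1) : (conjMatrix q).det = 1 := by
  have h := sphere_normSq q
  rw [conjMatrix, Matrix.det_fin_three]
  simp
  grind

/-- The double cover of `SO(3)` by the unit quaternions. -/
noncomputable def quaternionToSO3 : sphere (0 : ℍ[ℝ]) 1 →* SO3 where
  toFun q := ⟨⟨conjMatrix q, conjMatrix_mem_orthogonalGroup q⟩, det_conjMatrix q⟩
  map_one' := Subtype.ext <| Subtype.ext conjMatrix_one
  map_mul' p q := Subtype.ext <| Subtype.ext <| conjMatrix_mul p q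

theorem continuous_quaternionToSO3 : Continuous quaternionToSO3 := by
  have hre := Quaternion.continuous_re
  have hi := Quaternion.continuous_imI
  have hj := Quaternion.continuous_imJ
  have hk := Quaternion.continuous_imK
  have : Continuous conjMatrix := by
    refine continuous_matrix fun i j ↦ ?_
    fin_cases i <;> fin_cases j <;> simp [conjMatrix] <;> fun_prop
  exact ((this.comp continuous_subtype_val).subtype_mk _).subtype_mk _

/-- A rotation matrix whose angle is not `π` comes from a unit quaternion. -/
theorem exists_conjMatrix_eq_of_trace {M : Matrix (Fin 3) (Fin 3) ℝ}
    (hM : M ∈ Matrix.orthogonalGroup (Fin 3) ℝ) (hdet : M.det = 1) (htr : 0 < 1 + M.trace) :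
    ∃ q : sphere (0 : ℍ[ℝ]) 1, conjMatrix q = M := by
  have hr : M * M.transpose = 1 := (Matrix.mem_orthogonalGroup_iff _ _).1 hM
  have hc : M.transpose * M = 1 := (Matrix.mem_orthogonalGroup_iff' _ _).1 hM
  have hadj : M.transpose = M.adjugate := by
    calc M.transpose = M.transpose * (M * M.adjugate) := by rw [Matrix.mul_adjugate, hdet]; simp
      _ = M.adjugate := by rw [← mul_assoc, hc, one_mul]
  rw [Matrix.adjugate_fin_three] at hadj
  rw [← Matrix.ext_iff] at hr hc hadj
  simp only [Fin.forall_fin_succ, Matrix.mul_apply, Fin.sum_univ_three, Matrix.transpose_apply,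
    Matrix.one_apply, Matrix.trace, Matrix.diag] at hr hc hadj htr
  simp at hr hc hadj htr
  set T := 1 + (M 0 0 + M 1 1 + M 2 2) with hT
  set s := √T with hs
  have hs2 : s ^ 2 = T := Real.sq_sqrt htr.le
  have hs0 : s ≠ 0 := (Real.sqrt_pos.2 htr).ne'
  let q : ℍ[ℝ] := ⟨s / 2, (M 2 1 - M 1 2) / (2 * s), (M 0 2 - M 2 0) / (2 * s),
    (M 1 0 - M 0 1) / (2 * s)⟩
  have hq : q ∈ sphere (0 : ℍ[ℝ]) 1 := by
    apply mem_sphere_of_sq_add_eq_one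
    simp only [q]
    field_simp
    grind
  refine ⟨⟨q, hq⟩, ?_⟩
  ext i j
  fin_cases i <;> fin_cases j <;> simp [conjMatrix, q] <;> field_simp
  all_goals grind

/-- The quaternion unit `i` as an element of the unit sphere. -/
def unitI : sphere (0 : ℍ[ℝ]) 1 := ⟨⟨0, 1, 0, 0⟩, mem_sphere_of_sq_add_eq_one (by simp)⟩

/-- The quaternion unit `j` as an element of the unit sphere. -/
def unitJ : sphere (0 : ℍ[ℝ]) 1 := ⟨⟨0, 0, 1, 0⟩, mem_sphere_of_sq_add_eq_one (by simp)⟩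

/-- The quaternion unit `k` as an element of the unit sphere. -/
def unitK : sphere (0 : ℍ[ℝ]) 1 := ⟨⟨0, 0, 0, 1⟩, mem_sphere_of_sq_add_eq_one (by simp)⟩

theorem quaternionToSO3_surjective : Function.Surjective quaternionToSO3 := by
  have key (M : SO3) (u : sphere (0 : ℍ[ℝ]) 1)
      (h : 0 < 1 + (M.1.1 * conjMatrix u).trace) : ∃ q, quaternionToSO3 q = M := by
    obtain ⟨q, hq⟩ := exists_conjMatrix_eq_of_trace (M * quaternionToSO3 u).1.2
      (M * quaternionToSO3 u).2 h
    refine ⟨q * u⁻¹, ?_⟩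
    rw [map_mul, map_inv, mul_inv_eq_iff_eq_mul]
    exact Subtype.ext (Subtype.ext hq)
  intro M
  by_contra! hM
  have h₀ := not_lt.1 fun h ↦ (key M 1 h).elim hM
  have h₁ := not_lt.1 fun h ↦ (key M unitI h).elim hM
  have h₂ := not_lt.1 fun h ↦ (key M unitJ h).elim hM
  have h₃ := not_lt.1 fun h ↦ (key M unitK h).elim hM
  simp [conjMatrix, unitI, unitJ, unitK, Matrix.trace, Matrix.mul_apply,
    Fin.sum_univ_three] at h₀ h₁ h₂ h₃
  linarith

theorem unitI_mul_unitI : unitI * unitI = -1 := by ext <;> simp <;> simp [unitI]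

theorem unitJ_mul_unitJ : unitJ * unitJ = -1 := by ext <;> simp <;> simp [unitJ]

theorem unitJ_mul_unitI : unitJ * unitI = -unitK := by
  ext <;> simp <;> simp [unitI, unitJ, unitK]

theorem unitI_mul_unitJ : unitI * unitJ = unitK := by
  ext <;> simp <;> simp [unitI, unitJ, unitK]

/-- The powers of the quaternion unit `i`, indexed by exponents modulo `4`. -/
noncomputable def unitIPow : ZMod 4 → sphere (0 : ℍ[ℝ]) 1 := ![1, unitI, -1, -unitI]

theorem unitIPow_eq_pow (m : ZMod 4) : unitIPow m = unitI ^ m.val := by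
  have h := unitI_mul_unitI
  fin_cases m
  · exact (pow_zero _).symm
  · exact (pow_one _).symm
  · exact ((pow_two _).trans h).symm
  · exact ((pow_succ _ 2).trans (by rw [pow_two, h, neg_one_mul]; rfl)).symm

theorem unitIPow_add (m n : ZMod 4) : unitIPow (m + n) = unitIPow m * unitIPow n := by
  have h : unitI ^ 4 = 1 := by
    rw [pow_mul unitI 2 2, pow_two unitI, unitI_mul_unitI, neg_one_sq]
  simp only [unitIPow_eq_pow, ZMod.val_add, ← pow_eq_pow_mod _ h, pow_add]

theorem unitIPow_mul_unitJ (m : ZMod 4) : unitIPow m * unitJ = unitJ * unitIPow (-m) := by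
  have h : unitI * unitJ = -(unitJ * unitI) := by
    rw [unitI_mul_unitJ, unitJ_mul_unitI, neg_neg]
  fin_cases m
  · exact (one_mul _).trans (mul_one _).symm
  · exact h.trans (mul_neg unitJ unitI).symm
  · change -1 * unitJ = unitJ * -1
    rw [neg_one_mul, mul_neg_one]
  · change -unitI * unitJ = unitJ * unitI
    rw [neg_mul unitI unitJ, h, neg_neg]

theorem unitJ_mul_unitIPow (m : ZMod 4) :
    unitJ * unitIPow m = (![unitJ, -unitK, -unitJ, unitK] : Fin 4 → _) m := by
  fin_cases m
  · exact mul_one _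
  · exact unitJ_mul_unitI
  · exact mul_neg_one _
  · exact (mul_neg unitJ unitI).trans (neg_eq_iff_eq_neg.2 unitJ_mul_unitI)

/-- The embedding of the quaternion group into the unit quaternions, sending `a 1` to `i` and
`xa 0` to `j`. -/
noncomputable def quaternionGroupToSphere : QuaternionGroup 2 →* sphere (0 : ℍ[ℝ]) 1 where
  toFun
    | .a m => unitIPow m
    | .xa m => unitJ * unitIPow m
  map_one' := rfl
  map_mul' := by
    rintro (m | m) (n | n)
    · exact unitIPow_add m n
    · change unitJ * unitIPow (n - m) = unitIPow m * (unitJ * unitIPow n)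
      rw [← mul_assoc, unitIPow_mul_unitJ, mul_assoc, ← unitIPow_add, neg_add_eq_sub]
    · change unitJ * unitIPow (m + n) = unitJ * unitIPow m * unitIPow n
      rw [mul_assoc, ← unitIPow_add]
    · change unitIPow (2 + n - m) = unitJ * unitIPow m * (unitJ * unitIPow n)
      rw [mul_assoc, ← mul_assoc (unitIPow m), unitIPow_mul_unitJ, mul_assoc, ← unitIPow_add,
        ← mul_assoc, unitJ_mul_unitJ, neg_add_eq_sub, add_sub_assoc, unitIPow_add]
      rfl

theorem unitIPow_eq_one {m : ZMod 4} (h : unitIPow m = 1) : m = 0 := by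
  have h := congrArg (fun q : sphere (0 : ℍ[ℝ]) 1 ↦ (q : ℍ[ℝ]).re) h
  fin_cases m
  · rfl
  all_goals
    simp [unitIPow] at h
    norm_num [unitI] at h

theorem unitJ_mul_unitIPow_ne_one (m : ZMod 4) : unitJ * unitIPow m ≠ 1 := by
  rw [unitJ_mul_unitIPow]
  intro h
  have h := congrArg (fun q : sphere (0 : ℍ[ℝ]) 1 ↦ (q : ℍ[ℝ]).re) h
  fin_cases m <;> simp at h <;> simp [unitJ, unitK] at h

theorem quaternionGroupToSphere_injective : Function.Injective quaternionGroupToSphere := by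
  rw [injective_iff_map_eq_one]
  rintro (m | m) h
  · exact congrArg QuaternionGroup.a (unitIPow_eq_one h)
  · exact (unitJ_mul_unitIPow_ne_one m h).elim

theorem mem_range_quaternionGroupToSphere_iff (q : sphere (0 : ℍ[ℝ]) 1) :
    q ∈ quaternionGroupToSphere.range ↔ (q = 1 ∨ q = -1) ∨ (q = unitI ∨ q = -unitI) ∨
      (q = unitJ ∨ q = -unitJ) ∨ q = unitK ∨ q = -unitK := by
  constructor
  · rintro ⟨m | m, rfl⟩
    · change (unitIPow m = 1 ∨ unitIPow m = -1) ∨ (unitIPow m = unitI ∨ unitIPow m = -unitI) ∨ _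
      fin_cases m
      · exact .inl (.inl rfl)
      · exact .inr (.inl (.inl rfl))
      · exact .inl (.inr rfl)
      · exact .inr (.inl (.inr rfl))
    · obtain ⟨q, hq⟩ : ∃ q, q = quaternionGroupToSphere (.xa m) := ⟨_, rfl⟩
      rw [← hq]
      replace hq := hq.trans (unitJ_mul_unitIPow m)
      refine .inr (.inr ?_)
      fin_cases m
      · exact .inl (.inl hq)
      · exact .inr (.inr hq)
      · exact .inl (.inr hq)
      · exact .inr (.inl hq)
  · rintro ((rfl | rfl) | (rfl | rfl) | (rfl | rfl) | rfl | rfl)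
    · exact ⟨.a 0, rfl⟩
    · exact ⟨.a 2, rfl⟩
    · exact ⟨.a 1, rfl⟩
    · exact ⟨.a 3, rfl⟩
    · exact ⟨.xa 0, unitJ_mul_unitIPow 0⟩
    · exact ⟨.xa 2, unitJ_mul_unitIPow 2⟩
    · exact ⟨.xa 3, unitJ_mul_unitIPow 3⟩
    · exact ⟨.xa 1, unitJ_mul_unitIPow 1⟩

theorem conjMatrix_neg (q : ℍ[ℝ]) : conjMatrix (-q) = conjMatrix q := by simp [conjMatrix]

theorem conjMatrix_unitI : conjMatrix unitI = Matrix.diagonal ![1, -1, -1] := by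
  ext i j
  fin_cases i <;> fin_cases j <;> simp [conjMatrix, unitI]

theorem conjMatrix_unitJ : conjMatrix unitJ = Matrix.diagonal ![-1, 1, -1] := by
  ext i j
  fin_cases i <;> fin_cases j <;> simp [conjMatrix, unitJ]

theorem conjMatrix_unitK : conjMatrix unitK = Matrix.diagonal ![-1, -1, 1] := by
  ext i j
  fin_cases i <;> fin_cases j <;> simp [conjMatrix, unitK]

theorem one_eq_diagonal : (1 : Matrix (Fin 3) (Fin 3) ℝ) = Matrix.diagonal ![1, 1, 1] := by
  ext i j
  fin_cases i <;> fin_cases j <;> simp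

theorem quaternionToSO3_mem_D2Set_iff (q : sphere (0 : ℍ[ℝ]) 1) :
    quaternionToSO3 q ∈ D2Set ↔ q ∈ quaternionGroupToSphere.range := by
  have hD : quaternionToSO3 q ∈ D2Set ↔ conjMatrix q = 1 ∨ conjMatrix q = conjMatrix unitI ∨
      conjMatrix q = conjMatrix unitJ ∨ conjMatrix q = conjMatrix unitK := by
    rw [conjMatrix_unitI, conjMatrix_unitJ, conjMatrix_unitK, one_eq_diagonal]
    rfl
  rw [hD, mem_range_quaternionGroupToSphere_iff]
  constructor
  · intro h
    have hq := sphere_normSq q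
    simp only [← Matrix.ext_iff, Fin.forall_fin_succ, conjMatrix_unitI, conjMatrix_unitJ,
      conjMatrix_unitK] at h
    simp [conjMatrix] at h
    simp only [Subtype.ext_iff, Quaternion.ext_iff]
    simp
    simp [unitI, unitJ, unitK]
    generalize (q : ℍ[ℝ]).re = a at *
    generalize (q : ℍ[ℝ]).imI = b at *
    generalize (q : ℍ[ℝ]).imJ = c at *
    generalize (q : ℍ[ℝ]).imK = d at *
    rcases h with h | h | h | h
    · have hb : b = 0 := by nlinarith
      have hc : c = 0 := by nlinarith
      have hd : d = 0 := by nlinarith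
      grind
    · have hb : a = 0 := by nlinarith
      have hc : c = 0 := by nlinarith
      have hd : d = 0 := by nlinarith
      grind
    · have hb : a = 0 := by nlinarith
      have hc : b = 0 := by nlinarith
      have hd : d = 0 := by nlinarith
      grind
    · have hb : a = 0 := by nlinarith
      have hc : b = 0 := by nlinarith
      have hd : c = 0 := by nlinarith
      grind
  · refine Or.imp ?_ <| Or.imp ?_ <| Or.imp ?_ ?_ <;> rintro (rfl | rfl)
    · exact conjMatrix_one
    · exact (conjMatrix_neg 1).trans conjMatrix_one
    · rfl
    · exact conjMatrix_neg _
    · rfl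
    · exact conjMatrix_neg _
    · rfl
    · exact conjMatrix_neg _

end

/-- If `D₂` is the subgroup of `SO(3)` consisting of the four diagonal matrices
`diag(±1, ±1, ±1)` with determinant 1, then the fundamental group of the coset space
`SO(3) ⧸ D₂` (with the quotient topology, at any basepoint) is isomorphic, as a group,
to the quaternion group `Q₈`. -/
theorem stmt3 (D₂ : Subgroup ↥SO3) (hD₂ : (D₂ : Set ↥SO3) = D2Set)
    (x : ↥SO3 ⧸ D₂) :
    Nonempty (FundamentalGroup (↥SO3 ⧸ D₂) x ≃* QuaternionGroup 2) := by
  have : FiniteDimensional ℝ (Quaternion ℝ) :=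
    .of_finrank_pos (by rw [Quaternion.finrank_eq_four]; norm_num)
  have : SimplyConnectedSpace (Metric.sphere (0 : Quaternion ℝ) 1) :=
    simplyConnectedSpace_sphere (by rw [Quaternion.finrank_eq_four]; norm_num)
  have : CompactSpace (Metric.sphere (0 : Quaternion ℝ) 1) :=
    isCompact_iff_compactSpace.1 (isCompact_sphere _ _)
  have hp : Topology.IsQuotientMap ((QuotientGroup.mk : SO3 → SO3 ⧸ D₂) ∘ quaternionToSO3) :=
    (QuotientGroup.isQuotientMap_mk _).comp
      (.of_surjective_continuous quaternionToSO3_surjective continuous_quaternionToSO3)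
  have hcov := hp.isQuotientCoveringMap_of_subgroupOp (G := quaternionGroupToSphere.range)
    (Set.finite_range quaternionGroupToSphere).isDiscrete fun {p q} ↦ by
      rw [Function.comp, Function.comp, QuotientGroup.eq, ← map_inv, ← map_mul,
        ← quaternionToSO3_mem_D2Set_iff, ← hD₂, SetLike.mem_coe]
  obtain ⟨q, hq⟩ := hp.surjective x
  let e : quaternionGroupToSphere.range.opᵐᵒᵖ ≃* quaternionGroupToSphere.range :=
    { toFun g := ⟨g.unop.1.unop, g.unop.2⟩
      invFun g := .op ⟨.op g, g.2⟩
      map_mul' _ _ := rfl }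
  exact ⟨(hcov.fundamentalGroupEquiv ⟨q, hq⟩).trans <| e.trans
    (MonoidHom.ofInjective quaternionGroupToSphere_injective).symm⟩
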